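/- arXiv:2602.05412 — 2 statements merged into one kernel-verified Lean document; each statement's English description precedes it below -/
import Mathlib

section
/- In the Construction 2 setup: suppose Γ₀ = Cay(G₀,S₀) is edge-regular with parameters (v₀,k₀,λ₀) where v₀ = |G₀| and k₀ = |S₀|, the subgroup {e} × H₀ is an (m₀/2)-regular clique of size m₀ in Γ₀, and v₀ = 4(k₀ − λ₀ − 1). Then Γ = Cay(G,S) is a Neumaier graph with parameters (4v₀, v₀ + 2k₀ + 1, 2k₀, m₀, 2m₀): it is non-complete, edge-regular with parameters (4v₀, v₀+2k₀+1, 2k₀), and the subgroup {e} × H₀ × C is an m₀-regular clique of size 2m₀ in Γ. -/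
/-- The Cayley graph of a group `G` with connection set `S`:
distinct vertices `x, y` are adjacent iff `y * x⁻¹ ∈ S` (symmetrised). -/
def cayley {G : Type*} [Group G] (S : Set G) : SimpleGraph G :=
  SimpleGraph.fromRel (fun x y => y * x⁻¹ ∈ S)

/-- A graph is edge-regular with parameters `(v, k, l)` if it has `v` vertices,
every vertex has degree `k`, and every two adjacent vertices have exactly `l`
common neighbours. -/
def IsEdgeRegularWith {V : Type*} (G : SimpleGraph V) (v k l : ℕ) : Prop :=
  Nat.card V = v ∧ (∀ x : V, (G.neighborSet x).ncard = k) ∧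
    ∀ x y : V, G.Adj x y → (G.commonNeighbors x y).ncard = l

/-- A clique `C` is `m`-regular if every vertex not in `C` is adjacent to
exactly `m` vertices of `C`. -/
def IsRegularClique {V : Type*} (G : SimpleGraph V) (C : Set V) (m : ℕ) : Prop :=
  G.IsClique C ∧ ∀ x ∉ C, (G.neighborSet x ∩ C).ncard = m

/-- A graph is strongly regular if it is non-complete, regular, every two
adjacent vertices have the same number of common neighbours, and every two
distinct non-adjacent vertices have the same number of common neighbours. -/
def IsStronglyRegular {V : Type*} (G : SimpleGraph V) : Prop :=
  G ≠ ⊤ ∧ (∃ k, ∀ x : V, (G.neighborSet x).ncard = k) ∧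
    (∃ l, ∀ x y : V, G.Adj x y → (G.commonNeighbors x y).ncard = l) ∧
    (∃ μ, ∀ x y : V, x ≠ y → ¬G.Adj x y → (G.commonNeighbors x y).ncard = μ)

/-- `T` is a relative difference set in `K` relative to the (forbidden)
subgroup `N` with multiplicity `lam`. -/
def IsRDS {K : Type*} [Group K] (N : Subgroup K) (T : Set K) (lam : ℕ) : Prop :=
  (∀ g : K, g ∉ N → {p : K × K | p.1 ∈ T ∧ p.2 ∈ T ∧ p.1 * p.2⁻¹ = g}.ncard = lam) ∧
  ∀ g ∈ N, g ≠ 1 → ¬∃ t₁ ∈ T, ∃ t₂ ∈ T, t₁ * t₂⁻¹ = g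

section CayleyGraph

variable {G : Type*} [Group G] {S : Set G}

theorem cayley_adj (hone : (1 : G) ∉ S) (hinv : S = S⁻¹) {x y : G} :
    (cayley S).Adj x y ↔ y * x⁻¹ ∈ S := by
  have hsymm : x * y⁻¹ ∈ S ↔ y * x⁻¹ ∈ S := by
    conv_lhs => rw [hinv]
    simp
  rw [cayley, SimpleGraph.fromRel_adj, hsymm, or_self, and_iff_right_iff_imp]
  rintro h rfl
  exact hone (by simpa using h)

theorem ncard_neighborSet_cayley (hone : (1 : G) ∉ S) (hinv : S = S⁻¹) (x : G) :
    ((cayley S).neighborSet x).ncard = S.ncard := by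
  rw [← Set.ncard_image_of_injective S (mul_left_injective x)]
  congr 1
  ext z
  rw [SimpleGraph.mem_neighborSet, cayley_adj hone hinv]
  constructor
  · exact fun h => ⟨_, h, by simp⟩
  · rintro ⟨w, hw, rfl⟩
    simpa using hw

theorem ncard_commonNeighbors_cayley (hone : (1 : G) ∉ S) (hinv : S = S⁻¹) (x y : G) :
    ((cayley S).commonNeighbors x y).ncard = {w | w ∈ S ∧ y * x⁻¹ * w⁻¹ ∈ S}.ncard := by
  rw [← Set.ncard_image_of_injective {w | w ∈ S ∧ y * x⁻¹ * w⁻¹ ∈ S} (mul_left_injective x)]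
  congr 1
  have hmem : ∀ g, g ∈ S ↔ g⁻¹ ∈ S := fun g => by conv_lhs => rw [hinv, Set.mem_inv]
  ext z
  have hz : z ∈ (cayley S).commonNeighbors x y ↔ z * x⁻¹ ∈ S ∧ y * z⁻¹ ∈ S := by
    rw [SimpleGraph.mem_commonNeighbors, cayley_adj hone hinv, cayley_adj hone hinv,
      hmem (z * y⁻¹), mul_inv_rev, inv_inv]
  rw [hz]
  constructor
  · exact fun ⟨h₁, h₂⟩ => ⟨z * x⁻¹, ⟨h₁, by simpa using h₂⟩, by simp⟩
  · rintro ⟨w, ⟨hw, hw'⟩, rfl⟩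
    exact ⟨by simpa using hw, by simpa [mul_assoc] using hw'⟩

end CayleyGraph

section RelativeDifferenceSet

/-- For a reversible relative difference set, the difference representations of an element
outside the forbidden subgroup are counted by product representations. -/
theorem IsRDS.ncard_mul_inv {K : Type*} [Group K] {N : Subgroup K} {T : Set K} {l : ℕ}
    (hT : IsRDS N T l) (hrev : T = T⁻¹) {g : K} (hg : g ∉ N) :
    {w | w ∈ T ∧ g * w⁻¹ ∈ T}.ncard = l := by
  have hmem : ∀ g, g ∈ T ↔ g⁻¹ ∈ T := fun g => by conv_lhs => rw [hrev, Set.mem_inv]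
  rw [← hT.1 g hg]
  symm
  refine Set.ncard_congr (fun p _ => p.2⁻¹) ?_ ?_ ?_
  · rintro ⟨p, q⟩ ⟨hp, hq, rfl⟩
    exact ⟨(hmem q).1 hq, by simpa using hp⟩
  · rintro ⟨p, q⟩ ⟨p', q'⟩ ⟨-, -, h⟩ ⟨-, -, h'⟩ hqq
    obtain rfl : q = q' := inv_injective hqq
    obtain rfl : p = p' := mul_right_cancel (h.trans h'.symm)
    rfl
  · rintro w ⟨hw, hw'⟩
    exact ⟨(g * w⁻¹, w⁻¹), ⟨hw', (hmem w).1 hw, by simp⟩, by simp⟩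

variable {H C : Type*} [Group H] [Group C] {T : Set (H × C)} {l : ℕ}

theorem IsRDS.snd_eq_of_fst_eq
    (hT : IsRDS ((⊥ : Subgroup H).prod (⊤ : Subgroup C)) T l) {h : H} {x y : C}
    (hx : (h, x) ∈ T) (hy : (h, y) ∈ T) : x = y := by
  by_contra hne
  refine hT.2 ((h, x) * (h, y)⁻¹) (by simp [Subgroup.mem_prod]) ?_ ⟨_, hx, _, hy, rfl⟩
  intro h1
  rw [mul_inv_eq_one] at h1
  exact hne (congrArg Prod.snd h1)

/-- A semiregular relative difference set relative to the second factor is the graph of a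
function. -/
theorem IsRDS.exists_mem_iff [Finite H] [Finite C]
    (hT : IsRDS ((⊥ : Subgroup H).prod (⊤ : Subgroup C)) T l) (hcard : T.ncard = Nat.card H) :
    ∃ f : H → C, ∀ h x, (h, x) ∈ T ↔ x = f h := by
  have hinj : Set.InjOn Prod.fst T := by
    rintro ⟨h, x⟩ hx ⟨h', y⟩ hy (rfl : h = h')
    rw [hT.snd_eq_of_fst_eq hx hy]
  have himage : Prod.fst '' T = Set.univ := by
    rw [Set.eq_univ_iff_ncard, hinj.ncard_image, hcard]
  have hex : ∀ h, ∃ x, (h, x) ∈ T := by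
    intro h
    obtain ⟨⟨h', x⟩, hx, rfl⟩ : h ∈ Prod.fst '' T := himage ▸ Set.mem_univ h
    exact ⟨x, hx⟩
  choose f hf using hex
  refine ⟨f, fun h x => ⟨fun hx => hT.snd_eq_of_fst_eq hx (hf h), ?_⟩⟩
  rintro rfl
  exact hf h

end RelativeDifferenceSet

section OrderTwo

variable {C : Type*} [Group C]

theorem eq_one_or_eq_of_card_eq_two (hC : Nat.card C = 2) {c : C} (hc : c ≠ 1) (x : C) :
    x = 1 ∨ x = c := by
  obtain ⟨y, -, hy⟩ := (Nat.card_eq_two_iff' (1 : C)).1 hC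
  by_cases hx : x = 1
  · exact Or.inl hx
  · exact Or.inr ((hy x hx).trans (hy c hc).symm)

end OrderTwo

section CylinderSet

variable {A H C : Type*} [Group A] {A₀ : Subgroup A}

/-- The elements of `A × H × C` whose projection to `A × H` lies in the subset `U` of
`A₀ × H`. -/
def cylinder (C : Type*) (U : Set (↥A₀ × H)) : Set (A × H × C) :=
  {p | ∃ h : p.1 ∈ A₀, ((⟨p.1, h⟩ : ↥A₀), p.2.1) ∈ U}

theorem ncard_cylinder (hC : Nat.card C = 2) (U : Set (↥A₀ × H)) :
    (cylinder C U).ncard = 2 * U.ncard := by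
  have hinj : Function.Injective
      (fun q : (↥A₀ × H) × C => ((q.1.1 : A), q.1.2, q.2)) := by
    rintro ⟨⟨a, h⟩, x⟩ ⟨⟨a', h'⟩, x'⟩ heq
    simp only [Prod.mk.injEq, SetLike.coe_eq_coe] at heq ⊢
    tauto
  have himage : cylinder C U =
      (fun q : (↥A₀ × H) × C => ((q.1.1 : A), q.1.2, q.2)) '' (U ×ˢ Set.univ) := by
    ext ⟨a, h, x⟩
    simp [cylinder]
  rw [himage, Set.ncard_image_of_injective _ hinj, Set.ncard_prod, Set.ncard_univ, hC, mul_comm]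

theorem ncard_compl_of_index_eq_two [Finite A] (hA₀ : A₀.index = 2) :
    {a : A | a ∉ A₀}.ncard = Nat.card A₀ := by
  have h1 := Set.ncard_add_ncard_compl (A₀ : Set A)
  have h2 := A₀.card_mul_index
  have h3 : (A₀ : Set A).ncard = Nat.card A₀ := rfl
  have h4 : {a : A | a ∉ A₀} = (A₀ : Set A)ᶜ := rfl
  rw [h4]
  rw [hA₀] at h2
  omega

theorem ncard_setOf_notMem_and_mem [Finite A] (hA₀ : A₀.index = 2) (U : Set (H × C)) :
    {p : A × H × C | p.1 ∉ A₀ ∧ p.2 ∈ U}.ncard = Nat.card A₀ * U.ncard := by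
  rw [← ncard_compl_of_index_eq_two hA₀, ← Set.ncard_prod]
  rfl

end CylinderSet

section ConnectionSet

variable {A H C : Type*} [CommGroup A] [CommGroup H] {A₀ : Subgroup A}

/-- The connection set `(A ∖ A₀)T ∪ S₀C ∪ {c}` in `A × H × C`. -/
def connectionSet (S₀ : Set (↥A₀ × H)) (T : Set (H × C)) (c : C) : Set (A × H × C) :=
  {p | p.1 ∉ A₀ ∧ p.2 ∈ T} ∪ cylinder C S₀ ∪ {(1, 1, c)}

variable {S₀ : Set (↥A₀ × H)} {T : Set (H × C)} {c : C} {l : ℕ}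

theorem mem_connectionSet_of_notMem {a : A} (ha : a ∉ A₀) (q : H × C) :
    (a, q) ∈ connectionSet S₀ T c ↔ q ∈ T := by
  have h1 : a ≠ 1 := fun h => ha (h ▸ A₀.one_mem)
  simp [connectionSet, cylinder, ha, h1]

theorem mem_connectionSet_coe (a : A₀) (h : H) (x : C) :
    ((a : A), h, x) ∈ connectionSet S₀ T c ↔ (a, h) ∈ S₀ ∨ a = 1 ∧ h = 1 ∧ x = c := by
  simp [connectionSet, cylinder, or_comm]

theorem ncard_connectionSet [Finite A] [Finite H] [Finite C] (hA₀ : A₀.index = 2)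
    (hC : Nat.card C = 2) (hS₀e : (1 : ↥A₀ × H) ∉ S₀) (hTcard : T.ncard = Nat.card H) :
    (connectionSet S₀ T c).ncard = Nat.card (↥A₀ × H) + 2 * S₀.ncard + 1 := by
  rw [connectionSet, Set.ncard_union_eq, Set.ncard_union_eq, Set.ncard_singleton,
    ncard_cylinder hC, ncard_setOf_notMem_and_mem hA₀, hTcard, Nat.card_prod]
  · rw [Set.disjoint_left]
    rintro p ⟨hp, -⟩ ⟨hp', -⟩
    exact hp hp'
  · rw [Set.disjoint_singleton_right]
    rintro (h | ⟨_, h⟩)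
    · exact h.1 A₀.one_mem
    · exact hS₀e h

variable [Group C]

theorem one_notMem_connectionSet (hS₀e : (1 : ↥A₀ × H) ∉ S₀) (hc : c ≠ 1) :
    (1 : A × H × C) ∉ connectionSet S₀ T c := by
  have h := mem_connectionSet_coe (S₀ := S₀) (T := T) (c := c) 1 1 1
  intro h'
  rcases h.1 h' with h' | ⟨-, -, h'⟩
  · exact hS₀e h'
  · exact hc h'.symm

theorem connectionSet_eq_inv (hC : Nat.card C = 2) (hc : c ≠ 1) (hS₀inv : S₀ = S₀⁻¹)
    (hTrev : T = T⁻¹) : connectionSet S₀ T c = (connectionSet S₀ T c)⁻¹ := by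
  have hcc : c⁻¹ = c := by
    rcases eq_one_or_eq_of_card_eq_two hC hc c⁻¹ with h | h
    · exact absurd (inv_eq_one.1 h) hc
    · exact h
  ext ⟨a, h, x⟩
  rw [Set.mem_inv]
  by_cases ha : a ∈ A₀
  · lift a to A₀ using ha
    have h2 := mem_connectionSet_coe (S₀ := S₀) (T := T) (c := c) a⁻¹ h⁻¹ x⁻¹
    have h3 : (a, h) ∈ S₀ ↔ (a⁻¹, h⁻¹) ∈ S₀ := by
      conv_lhs => rw [hS₀inv]
      rfl
    have h4 : x⁻¹ = c ↔ x = c := by rw [inv_eq_iff_eq_inv, hcc]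
    rw [inv_eq_one, inv_eq_one, h4, ← h3] at h2
    rw [mem_connectionSet_coe]
    exact h2.symm
  · have ha' : a⁻¹ ∉ A₀ := by simpa using ha
    rw [mem_connectionSet_of_notMem ha]
    refine Iff.trans ?_ (mem_connectionSet_of_notMem ha' (h, x)⁻¹).symm
    conv_lhs => rw [hTrev]
    rfl

/-- The number of factorisations of the central involution over the connection set. -/
theorem ncard_factorisations_involution
    (hC : Nat.card C = 2) (hc : c ≠ 1) (hS₀e : (1 : ↥A₀ × H) ∉ S₀) (hS₀inv : S₀ = S₀⁻¹)
    (hTrev : T = T⁻¹) (hTrds : IsRDS ((⊥ : Subgroup H).prod (⊤ : Subgroup C)) T l) :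
    {w | w ∈ connectionSet S₀ T c ∧
      ((1, 1, c) : A × H × C) * w⁻¹ ∈ connectionSet S₀ T c}.ncard = 2 * S₀.ncard := by
  rw [← ncard_cylinder hC]
  congr 1
  have hone := one_notMem_connectionSet (A₀ := A₀) (S₀ := S₀) (T := T) hS₀e hc
  ext ⟨a, h, x⟩
  rw [Set.mem_ofPred_eq]
  by_cases ha : a ∈ A₀
  · lift a to A₀ using ha
    have h2 := mem_connectionSet_coe (S₀ := S₀) (T := T) (c := c) a⁻¹ h⁻¹ (c * x⁻¹)
    have h3 : (a, h) ∈ S₀ ↔ (a⁻¹, h⁻¹) ∈ S₀ := by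
      conv_lhs => rw [hS₀inv]
      rfl
    have h4 : ((1, 1, c) : A × H × C) * ((a : A), h, x)⁻¹ = (((a⁻¹ : A₀) : A), h⁻¹, c * x⁻¹) := by
      simp
    have h5 : ((a : A), h, x) ∈ cylinder C S₀ ↔ (a, h) ∈ S₀ := by simp [cylinder]
    rw [h4, h2, h5, mem_connectionSet_coe, ← h3]
    constructor
    · rintro ⟨h | ⟨rfl, rfl, rfl⟩, h'⟩
      · exact h
      · rcases h' with h' | ⟨-, -, h'⟩
        · exact h'
        · exact absurd (by simpa using h'.symm) hc
    · exact fun h => ⟨Or.inl h, Or.inl h⟩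
  · have ha' : a⁻¹ ∉ A₀ := by simpa using ha
    have h4 : ((1, 1, c) : A × H × C) * (a, h, x)⁻¹ = (a⁻¹, h⁻¹, c * x⁻¹) := by simp
    rw [h4, mem_connectionSet_of_notMem ha, mem_connectionSet_of_notMem ha']
    constructor
    · rintro ⟨h1, h2⟩
      have h3 : (h⁻¹, x⁻¹) ∈ T := by
        rw [hTrev]
        simpa using h1
      exact absurd (by simpa using hTrds.snd_eq_of_fst_eq h2 h3) hc
    · rintro ⟨h, -⟩
      exact absurd h ha

/-- The number of factorisations over the connection set of an element of `S₀C`. -/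
theorem ncard_factorisations_of_mem [Finite A] [Finite H] [Finite C] (hA₀ : A₀.index = 2)
    (hC : Nat.card C = 2) (hc : c ≠ 1) (hS₀e : (1 : ↥A₀ × H) ∉ S₀)
    (hTrev : T = T⁻¹) (hTrds : IsRDS ((⊥ : Subgroup H).prod (⊤ : Subgroup C)) T l)
    {b : A₀} {g : H} (hs : (b, g) ∈ S₀) (hg : g ≠ 1) (y : C) :
    {w | w ∈ connectionSet S₀ T c ∧
      ((b : A), g, y) * w⁻¹ ∈ connectionSet S₀ T c}.ncard =
    Nat.card A₀ * l + 2 * {w | w ∈ S₀ ∧ (b, g) * w⁻¹ ∈ S₀}.ncard + 2 := by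
  have hcases := eq_one_or_eq_of_card_eq_two hC hc
  have hcc : c * c = 1 := by
    rcases hcases (c * c) with h | h
    · exact h
    · exact absurd (by simpa using h) hc
  have hgN : (g, y) ∉ (⊥ : Subgroup H).prod (⊤ : Subgroup C) := by simp [Subgroup.mem_prod, hg]
  have hbg : ((1, 1, c) : A × H × C) ≠ ((b : A), g, y * c) := by
    intro h
    simp only [Prod.mk.injEq] at h
    exact hg h.2.1.symm
  rw [← ncard_cylinder hC, ← hTrds.ncard_mul_inv hTrev hgN, ← ncard_setOf_notMem_and_mem hA₀,
    ← Set.ncard_pair hbg, ← Set.ncard_union_eq, ← Set.ncard_union_eq]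
  · congr 1
    ext ⟨a, h, x⟩
    rw [Set.mem_ofPred_eq]
    by_cases ha : a ∈ A₀
    · lift a to A₀ using ha
      have h4 : ((b : A), g, y) * ((a : A), h, x)⁻¹ =
          (((b * a⁻¹ : A₀) : A), g * h⁻¹, y * x⁻¹) := by simp
      have h6 : y * x⁻¹ = c ↔ x = y * c := by
        rcases hcases x with rfl | rfl <;> rcases hcases y with rfl | rfl <;>
          simp [hcc, hc, hc.symm, inv_eq_of_mul_eq_one_left hcc]
      rw [h4, mem_connectionSet_coe, mem_connectionSet_coe]
      simp only [Set.mem_union, Set.mem_ofPred_eq, cylinder, SetLike.coe_mem, not_true, false_and,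
        false_or, Set.mem_insert_iff, Set.mem_singleton_iff, Prod.mk.injEq, exists_true_left,
        Subtype.coe_eta, SetLike.coe_eq_coe, OneMemClass.coe_eq_one, h6, mul_inv_eq_one,
        Prod.inv_mk, Prod.mk_mul_mk]
      constructor
      · rintro ⟨h1 | ⟨rfl, rfl, rfl⟩, h2 | ⟨h3, h4, h5⟩⟩
        · exact Or.inl ⟨h1, h2⟩
        · exact Or.inr (Or.inr ⟨h3.symm, h4.symm, h5⟩)
        · exact Or.inr (Or.inl ⟨rfl, rfl, rfl⟩)
        · exact absurd h4 hg
      · rintro (⟨h1, h2⟩ | ⟨rfl, rfl, rfl⟩ | ⟨rfl, rfl, rfl⟩)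
        · exact ⟨Or.inl h1, Or.inl h2⟩
        · exact ⟨Or.inr ⟨rfl, rfl, rfl⟩, Or.inl (by simpa using hs)⟩
        · exact ⟨Or.inl hs, Or.inr ⟨rfl, rfl, rfl⟩⟩
    · have ha' : (b : A) * a⁻¹ ∉ A₀ := by
        rwa [A₀.mul_mem_cancel_left b.2, inv_mem_iff]
      have h4 : ((b : A), g, y) * (a, h, x)⁻¹ = ((b : A) * a⁻¹, (g, y) * (h, x)⁻¹) := by simp
      have ha1 : a ≠ 1 := fun h => ha (h ▸ A₀.one_mem)
      have hab : a ≠ b := fun h => ha (h ▸ b.2)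
      rw [h4, mem_connectionSet_of_notMem ha, mem_connectionSet_of_notMem ha']
      simp [cylinder, ha, ha1, hab]
  · rw [Set.disjoint_right]
    rintro p hp hp'
    simp only [Set.mem_insert_iff, Set.mem_singleton_iff] at hp
    rcases hp with rfl | rfl <;> rcases hp' with h | ⟨_, h⟩
    · exact h.1 A₀.one_mem
    · exact hS₀e h.1
    · exact h.1 b.2
    · exact hS₀e (by simpa [Prod.mk_one_one] using h.2)
  · rw [Set.disjoint_left]
    rintro p ⟨hp, -⟩ ⟨hp', -⟩
    exact hp hp'

/-- The number of factorisations over the connection set of an element of `(A ∖ A₀)T`. -/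
theorem ncard_factorisations_of_notMem [Finite A] [Finite H] [Finite C] (hA₀ : A₀.index = 2)
    (hC : Nat.card C = 2) (hc : c ≠ 1) (hTcard : T.ncard = Nat.card H)
    (hTrds : IsRDS ((⊥ : Subgroup H).prod (⊤ : Subgroup C)) T l)
    {b : A} (hb : b ∉ A₀) {t : H × C} (ht : t ∈ T) :
    {w | w ∈ connectionSet S₀ T c ∧ (b, t) * w⁻¹ ∈ connectionSet S₀ T c}.ncard =
      2 * S₀.ncard := by
  obtain ⟨f, hf⟩ := hTrds.exists_mem_iff hTcard
  obtain ⟨g, y⟩ := t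
  have hcases := eq_one_or_eq_of_card_eq_two hC hc
  have hcomm : ∀ u v : C, u * v = v * u := by
    intro u v
    rcases hcases u with rfl | rfl <;> rcases hcases v with rfl | rfl <;> simp
  set Q : Set (A × H × C) :=
    (fun w : ↥A₀ × H => ((w.1 : A), w.2, (f (g * w.2⁻¹))⁻¹ * y)) '' S₀ with hQ
  have hQcard : Q.ncard = S₀.ncard := by
    refine Set.ncard_image_of_injective _ ?_
    rintro ⟨a, h⟩ ⟨a', h'⟩ heq
    simp only [Prod.mk.injEq, SetLike.coe_eq_coe] at heq ⊢
    exact ⟨heq.1, heq.2.1⟩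
  have hmemQ : ∀ (a : A₀) h x, ((a : A), h, x) ∈ Q ↔ (a, h) ∈ S₀ ∧ (g, y) * (h, x)⁻¹ ∈ T := by
    intro a h x
    have h1 : (g, y) * (h, x)⁻¹ = (g * h⁻¹, y * x⁻¹) := rfl
    rw [h1, hf]
    have h2 : y * x⁻¹ = f (g * h⁻¹) ↔ (f (g * h⁻¹))⁻¹ * y = x := by
      rw [mul_inv_eq_iff_eq_mul, inv_mul_eq_iff_eq_mul]
    rw [h2, hQ]
    constructor
    · rintro ⟨⟨a', h'⟩, hw, heq⟩
      simp only [Prod.mk.injEq, SetLike.coe_eq_coe] at heq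
      obtain ⟨rfl, rfl, rfl⟩ := heq
      exact ⟨hw, rfl⟩
    · rintro ⟨hw, rfl⟩
      exact ⟨_, hw, rfl⟩
  have hnotQ : ∀ a q, a ∉ A₀ → (a, q) ∉ Q := by
    rintro a q ha ⟨w, -, heq⟩
    exact ha ((show (w.1 : A) = a from congrArg Prod.fst heq) ▸ w.1.2)
  have hdiv : ∀ a, a ∉ A₀ → b * a⁻¹ ∈ A₀ := by
    intro a ha
    rw [Subgroup.mul_mem_iff_of_index_two hA₀, inv_mem_iff]
    tauto
  set R : Set (A × H × C) := (fun w => (b, g, y) * w⁻¹) '' Q with hR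
  have hRcard : R.ncard = S₀.ncard := by
    rw [← hQcard]
    exact Set.ncard_image_of_injective _ fun u v huv => inv_injective (mul_left_cancel huv)
  have hinvol : ∀ w : A × H × C, (b, g, y) * ((b, g, y) * w⁻¹)⁻¹ = w := by
    rintro ⟨a, h, x⟩
    simp [hcomm x]
  have hmemR : ∀ w, w ∈ R ↔ (b, g, y) * w⁻¹ ∈ Q := by
    intro w
    constructor
    · rintro ⟨w, hw, rfl⟩
      simpa only [hinvol] using hw
    · exact fun hw => ⟨_, hw, hinvol w⟩
  have key : ∀ w : A × H × C, w.1 ∈ A₀ →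
      (w ∈ connectionSet S₀ T c ∧ (b, g, y) * w⁻¹ ∈ connectionSet S₀ T c ↔ w ∈ Q) := by
    rintro ⟨a, h, x⟩ (ha : a ∈ A₀)
    lift a to A₀ using ha
    have h1 : (b, g, y) * ((a : A), h, x)⁻¹ = (b * (a : A)⁻¹, (g, y) * (h, x)⁻¹) := rfl
    have h2 : b * (a : A)⁻¹ ∉ A₀ := by
      rwa [A₀.mul_mem_cancel_right (inv_mem a.2)]
    rw [h1, mem_connectionSet_of_notMem h2, mem_connectionSet_coe, hmemQ]
    constructor
    · rintro ⟨h3 | ⟨rfl, rfl, rfl⟩, h4⟩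
      · exact ⟨h3, h4⟩
      · have h5 : (g, y * x⁻¹) ∈ T := by simpa using h4
        exact absurd (by simpa using hTrds.snd_eq_of_fst_eq h5 ht) hc
    · exact fun ⟨h3, h4⟩ => ⟨Or.inl h3, h4⟩
  rw [two_mul]
  nth_rw 1 [← hQcard]
  rw [← hRcard, ← Set.ncard_union_eq]
  · congr 1
    ext w
    rw [Set.mem_ofPred_eq, Set.mem_union, hmemR]
    by_cases hw : w.1 ∈ A₀
    · have h1 : (b, g, y) * w⁻¹ ∉ Q := by
        refine hnotQ _ _ ?_
        change b * w.1⁻¹ ∉ A₀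
        rwa [A₀.mul_mem_cancel_right (inv_mem hw)]
      rw [key w hw]
      tauto
    · have h1 := key ((b, g, y) * w⁻¹) (hdiv _ hw)
      rw [hinvol] at h1
      have h2 : w ∉ Q := hnotQ w.1 w.2 hw
      tauto
  · rw [Set.disjoint_left]
    intro w hw hw'
    rw [hmemR] at hw'
    have h1 : w.1 ∈ A₀ := by
      by_contra h
      exact hnotQ w.1 w.2 h hw
    refine hnotQ _ _ ?_ hw'
    change b * w.1⁻¹ ∉ A₀
    rwa [A₀.mul_mem_cancel_right (inv_mem h1)]

end ConnectionSet

theorem statement11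
    {A : Type*} [CommGroup A] [Finite A]
    (A₀ : Subgroup A) (hA₀nt : A₀ ≠ ⊥) (hA₀idx : A₀.index = 2)
    {H₀ : Type*} [CommGroup H₀] [Finite H₀] [Nontrivial H₀]
    {C : Type*} [Group C] [Finite C] (hC : Nat.card C = 2) (c : C) (hc : c ≠ 1)
    (m₀ : ℕ) (hm₀ : m₀ = Nat.card H₀) (hm₀even : Even m₀)
    (S₀ : Set (↥A₀ × H₀)) (hS₀e : (1 : ↥A₀ × H₀) ∉ S₀) (hS₀inv : S₀ = S₀⁻¹)
    (hS₀A : ∀ p ∈ S₀, p.2 ≠ (1 : H₀))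
    (T : Set (H₀ × C)) (hTrev : T = T⁻¹) (hTcard : T.ncard = m₀)
    (hTrds : IsRDS ((⊥ : Subgroup H₀).prod (⊤ : Subgroup C)) T (m₀ / 2))
    (S : Set (A × H₀ × C))
    (hSdef : S = {p : A × H₀ × C | p.1 ∉ A₀ ∧ p.2 ∈ T} ∪
        {p : A × H₀ × C | ∃ h : p.1 ∈ A₀, ((⟨p.1, h⟩ : ↥A₀), p.2.1) ∈ S₀} ∪
        {((1 : A), (1 : H₀), c)})
    (v₀ k₀ lam₀ : ℕ) (hv₀ : v₀ = Nat.card (↥A₀ × H₀)) (hk₀ : k₀ = S₀.ncard)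
    (hER₀ : IsEdgeRegularWith (cayley S₀) v₀ k₀ lam₀)
    (hclique₀ : IsRegularClique (cayley S₀) {p : ↥A₀ × H₀ | p.1 = 1} (m₀ / 2))
    (hclsize₀ : {p : ↥A₀ × H₀ | p.1 = 1}.ncard = m₀)
    (hcrit : (v₀ : ℤ) = 4 * ((k₀ : ℤ) - (lam₀ : ℤ) - 1)) :
    cayley S ≠ ⊤ ∧
    IsEdgeRegularWith (cayley S) (4 * v₀) (v₀ + 2 * k₀ + 1) (2 * k₀) ∧
    IsRegularClique (cayley S) {p : A × H₀ × C | p.1 = 1} m₀ ∧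
    {p : A × H₀ × C | p.1 = 1}.ncard = 2 * m₀ := by
  have hS : S = connectionSet S₀ T c := hSdef
  clear hSdef
  subst hm₀ hv₀ hk₀ hS
  have hone := one_notMem_connectionSet (A₀ := A₀) (S₀ := S₀) (T := T) hS₀e hc
  have hinv := connectionSet_eq_inv hC hc hS₀inv hTrev
  obtain ⟨b, hb⟩ : ∃ b, b ∉ A₀ := by
    by_contra! h
    rw [(Subgroup.eq_top_iff' A₀).2 h, Subgroup.index_top] at hA₀idx
    omega
  obtain ⟨t, ht⟩ : ∃ t, t ∉ T := by
    by_contra! h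
    rw [Set.eq_univ_of_forall h, Set.ncard_univ, Nat.card_prod, hC] at hTcard
    have : 0 < Nat.card H₀ := Nat.card_pos
    omega
  have hS₀clique : ∀ h : H₀, h ≠ 1 → ((1 : A₀), h) ∈ S₀ := by
    intro h hh
    have hadj := hclique₀.1 (x := (1, 1)) rfl (y := (1, h)) rfl (by simpa using hh.symm)
    simpa using (cayley_adj hS₀e hS₀inv).1 hadj
  refine ⟨?_, ⟨?_, ?_, ?_⟩, ⟨?_, ?_⟩, ?_⟩
  · intro htop
    have hne : (1 : A × H₀ × C) ≠ (b, t) := by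
      intro h
      exact hb ((show (1 : A) = b from congrArg Prod.fst h) ▸ A₀.one_mem)
    have hadj : (cayley (connectionSet S₀ T c)).Adj 1 (b, t) := by
      rw [htop]
      exact hne
    rw [cayley_adj hone hinv, inv_one, mul_one, mem_connectionSet_of_notMem hb] at hadj
    exact ht hadj
  · have h := A₀.card_mul_index
    rw [Nat.card_prod, Nat.card_prod, Nat.card_prod, hC, ← h, hA₀idx]
    ring
  · intro x
    rw [ncard_neighborSet_cayley hone hinv, ncard_connectionSet hA₀idx hC hS₀e hTcard]
  · intro x y hxy
    rw [cayley_adj hone hinv] at hxy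
    rw [ncard_commonNeighbors_cayley hone hinv]
    generalize y * x⁻¹ = s at hxy
    obtain ⟨a, g, z⟩ := s
    by_cases ha : a ∈ A₀
    · lift a to A₀ using ha
      rcases (mem_connectionSet_coe _ _ _).1 hxy with hs | ⟨rfl, rfl, rfl⟩
      · have hg : g ≠ 1 := hS₀A _ hs
        have hlam : {w | w ∈ S₀ ∧ (a, g) * w⁻¹ ∈ S₀}.ncard = lam₀ := by
          have hadj : (cayley S₀).Adj 1 (a, g) := by
            rw [cayley_adj hS₀e hS₀inv]
            simpa using hs
          rw [← hER₀.2.2 _ _ hadj, ncard_commonNeighbors_cayley hS₀e hS₀inv]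
          simp
        rw [ncard_factorisations_of_mem hA₀idx hC hc hS₀e hTrev hTrds hs hg, hlam]
        have hv : Nat.card (↥A₀ × H₀) = 2 * (Nat.card A₀ * (Nat.card H₀ / 2)) := by
          obtain ⟨r, hr⟩ := hm₀even
          rw [Nat.card_prod, hr, ← two_mul, Nat.mul_div_cancel_left r two_pos]
          ring
        omega
      · exact ncard_factorisations_involution hC hc hS₀e hS₀inv hTrev hTrds
    · exact ncard_factorisations_of_notMem hA₀idx hC hc hTcard hTrds ha
        ((mem_connectionSet_of_notMem ha _).1 hxy)
  · rintro ⟨a, h, x⟩ (rfl : a = 1) ⟨a', h', x'⟩ (rfl : a' = 1) hne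
    rw [cayley_adj hone hinv]
    have hdiff : ((1 : A), h', x') * ((1 : A), h, x)⁻¹ =
        (((1 : A₀) : A), h' * h⁻¹, x' * x⁻¹) := by simp
    rw [hdiff, mem_connectionSet_coe]
    by_cases hh : h' = h
    · subst hh
      right
      refine ⟨rfl, by simp, (eq_one_or_eq_of_card_eq_two hC hc _).resolve_left ?_⟩
      rw [mul_inv_eq_one]
      rintro rfl
      exact hne rfl
    · exact Or.inl (hS₀clique _ (by rwa [Ne, mul_inv_eq_one]))
  · rintro ⟨a, g, y⟩ (ha : a ≠ 1)
    by_cases haA : a ∈ A₀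
    · lift a to A₀ using haA
      have ha1 : a ≠ 1 := by simpa using ha
      have h₀ := hclique₀.2 (a, g) ha1
      have hcyl : (cayley (connectionSet S₀ T c)).neighborSet ((a : A), g, y) ∩
          {p : A × H₀ × C | p.1 = 1} =
          cylinder C ((cayley S₀).neighborSet (a, g) ∩ {p : ↥A₀ × H₀ | p.1 = 1}) := by
        ext ⟨b, h, x⟩
        constructor
        · rintro ⟨hadj, (rfl : b = 1)⟩
          refine ⟨A₀.one_mem, ?_, rfl⟩
          rw [SimpleGraph.mem_neighborSet, cayley_adj hone hinv] at hadj
          rw [SimpleGraph.mem_neighborSet, cayley_adj hS₀e hS₀inv]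
          refine ((mem_connectionSet_coe (1 * a⁻¹) (h * g⁻¹) (x * y⁻¹)).1 hadj).resolve_right ?_
          rintro ⟨h1, -⟩
          exact ha1 (by simpa using h1)
        · rintro ⟨hbA, hadj, hb1⟩
          obtain rfl : b = 1 := congrArg Subtype.val hb1
          refine ⟨?_, rfl⟩
          rw [SimpleGraph.mem_neighborSet, cayley_adj hS₀e hS₀inv] at hadj
          rw [SimpleGraph.mem_neighborSet, cayley_adj hone hinv]
          exact (mem_connectionSet_coe (1 * a⁻¹) (h * g⁻¹) (x * y⁻¹)).2 (Or.inl hadj)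
      rw [hcyl, ncard_cylinder hC, h₀]
      exact Nat.two_mul_div_two_of_even hm₀even
    · rw [← hTcard, ← Set.ncard_image_of_injective T
        (f := fun q => ((1 : A), q * (g, y))) (fun q q' h => by simpa using h)]
      congr 1
      have ha' : 1 * a⁻¹ ∉ A₀ := by simpa using haA
      ext ⟨b, q⟩
      constructor
      · rintro ⟨hadj, (rfl : b = 1)⟩
        rw [SimpleGraph.mem_neighborSet, cayley_adj hone hinv] at hadj
        exact ⟨q * (g, y)⁻¹, (mem_connectionSet_of_notMem ha' _).1 hadj, by
          simp only [inv_mul_cancel_right]⟩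
      · rintro ⟨q', hq', heq⟩
        obtain ⟨rfl, rfl⟩ := Prod.mk.inj heq
        refine ⟨?_, rfl⟩
        rw [SimpleGraph.mem_neighborSet, cayley_adj hone hinv]
        refine (mem_connectionSet_of_notMem ha' (q' * (g, y) * (g, y)⁻¹)).2 ?_
        rwa [mul_inv_cancel_right]
  · have hcyl : {p : A × H₀ × C | p.1 = 1} = cylinder C {p : ↥A₀ × H₀ | p.1 = 1} := by
      ext ⟨a, h, x⟩
      constructor
      · rintro (rfl : a = 1)
        exact ⟨A₀.one_mem, rfl⟩
      · rintro ⟨h, ha⟩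
        exact congrArg Subtype.val ha
    rw [hcyl, ncard_cylinder hC, hclsize₀]
end

section
/- In the Construction 2 setup: if Γ₀ = Cay(G₀,S₀) is strongly regular, then Γ = Cay(G,S) is not strongly regular. More precisely, if every two adjacent vertices of Γ₀ have exactly λ₀ common neighbours and every two distinct non-adjacent vertices of Γ₀ have exactly μ₀ common neighbours, then Γ contains two pairs of distinct non-adjacent vertices having v₀ + 2μ₀ and 2μ₀ common neighbours respectively, where v₀ = |G₀| > 0. -/
theorem cayley_adj_iff {G : Type*} [Group G] {S : Set G} (h1 : (1 : G) ∉ S)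
    (hinv : ∀ x ∈ S, x⁻¹ ∈ S) (x y : G) : (cayley S).Adj x y ↔ y * x⁻¹ ∈ S := by
  rw [cayley, SimpleGraph.fromRel_adj]
  constructor
  · rintro ⟨-, h | h⟩
    · exact h
    · simpa using hinv _ h
  · intro h
    refine ⟨?_, Or.inl h⟩
    rintro rfl
    exact h1 (by simpa using h)

theorem mem_commonNeighbors_one_cayley_iff {G : Type*} [Group G] {S : Set G} (h1 : (1 : G) ∉ S)
    (hinv : ∀ x ∈ S, x⁻¹ ∈ S) (g z : G) :
    z ∈ (cayley S).commonNeighbors 1 g ↔ z ∈ S ∧ z * g⁻¹ ∈ S := by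
  simp [SimpleGraph.mem_commonNeighbors, cayley_adj_iff h1 hinv]

/-- Counting the elements of `A × H₀ × C` that lie over a set `U ⊆ A₀ × H₀`. -/
theorem ncard_image_prod_univ {A H₀ C : Type*} [Group A] (A₀ : Subgroup A) (U : Set (↥A₀ × H₀)) :
    {z : A × H₀ × C | ∃ h : z.1 ∈ A₀, ((⟨z.1, h⟩ : ↥A₀), z.2.1) ∈ U}.ncard =
      U.ncard * Nat.card C := by
  have himg : {z : A × H₀ × C | ∃ h : z.1 ∈ A₀, ((⟨z.1, h⟩ : ↥A₀), z.2.1) ∈ U} =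
      (fun p : (↥A₀ × H₀) × C => ((p.1.1 : A), p.1.2, p.2)) '' (U ×ˢ Set.univ) := by
    ext ⟨a, h, x⟩
    constructor
    · rintro ⟨ha, hU⟩
      exact ⟨((⟨a, ha⟩, h), x), ⟨hU, trivial⟩, rfl⟩
    · rintro ⟨⟨⟨⟨a, ha⟩, h⟩, x⟩, ⟨hU, -⟩, heq⟩
      obtain ⟨rfl, rfl, rfl⟩ : a = _ ∧ h = _ ∧ x = _ := by simpa using heq
      exact ⟨ha, hU⟩
  rw [himg, Set.ncard_image_of_injective, Set.ncard_prod, Set.ncard_univ]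
  rintro ⟨⟨⟨a, ha⟩, h⟩, x⟩ ⟨⟨⟨b, hb⟩, k⟩, y⟩ heq
  simpa [and_assoc] using heq

theorem statement12
    {A : Type*} [CommGroup A] [Finite A]
    (A₀ : Subgroup A) (hA₀nt : A₀ ≠ ⊥) (hA₀idx : A₀.index = 2)
    {H₀ : Type*} [CommGroup H₀] [Finite H₀] [Nontrivial H₀]
    {C : Type*} [Group C] [Finite C] (hC : Nat.card C = 2) (c : C) (hc : c ≠ 1)
    (m₀ : ℕ) (hm₀ : m₀ = Nat.card H₀) (hm₀even : Even m₀)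
    (S₀ : Set (↥A₀ × H₀)) (hS₀e : (1 : ↥A₀ × H₀) ∉ S₀) (hS₀inv : S₀ = S₀⁻¹)
    (hS₀A : ∀ p ∈ S₀, p.2 ≠ (1 : H₀))
    (T : Set (H₀ × C)) (hTrev : T = T⁻¹) (hTcard : T.ncard = m₀)
    (hTrds : IsRDS ((⊥ : Subgroup H₀).prod (⊤ : Subgroup C)) T (m₀ / 2))
    (S : Set (A × H₀ × C))
    (hSdef : S = {p : A × H₀ × C | p.1 ∉ A₀ ∧ p.2 ∈ T} ∪
        {p : A × H₀ × C | ∃ h : p.1 ∈ A₀, ((⟨p.1, h⟩ : ↥A₀), p.2.1) ∈ S₀} ∪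
        {((1 : A), (1 : H₀), c)})
    (v₀ lam₀ mu₀ : ℕ) (hv₀ : v₀ = Nat.card (↥A₀ × H₀))
    (hadj₀ : ∀ x y : ↥A₀ × H₀, (cayley S₀).Adj x y →
        ((cayley S₀).commonNeighbors x y).ncard = lam₀)
    (hnadj₀ : ∀ x y : ↥A₀ × H₀, x ≠ y → ¬(cayley S₀).Adj x y →
        ((cayley S₀).commonNeighbors x y).ncard = mu₀) :
    ¬ IsStronglyRegular (cayley S) ∧
    (∃ x y : A × H₀ × C, x ≠ y ∧ ¬(cayley S).Adj x y ∧
        ((cayley S).commonNeighbors x y).ncard = v₀ + 2 * mu₀) ∧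
    (∃ x y : A × H₀ × C, x ≠ y ∧ ¬(cayley S).Adj x y ∧
        ((cayley S).commonNeighbors x y).ncard = 2 * mu₀) := by
  have hcc : c⁻¹ = c := by
    have h : c ^ Nat.card C = 1 := pow_card_eq_one'
    rw [hC, pow_two] at h
    exact inv_eq_of_mul_eq_one_left h
  have hSmem : ∀ (b : A) (h : H₀) (x : C), (b, h, x) ∈ S ↔ (b ∉ A₀ ∧ (h, x) ∈ T) ∨
      (∃ hb : b ∈ A₀, ((⟨b, hb⟩ : ↥A₀), h) ∈ S₀) ∨ (b = 1 ∧ h = 1 ∧ x = c) := by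
    intro b h x
    rw [hSdef]
    simp only [Set.mem_union, Set.mem_ofPred_eq, Set.mem_singleton_iff, Prod.mk.injEq, or_assoc]
  have hTinv : ∀ t ∈ T, t⁻¹ ∈ T := fun t ht => by
    rw [hTrev] at ht
    exact ht
  have hS₀inv' : ∀ p ∈ S₀, p⁻¹ ∈ S₀ := fun p hp => by
    rw [hS₀inv] at hp
    exact hp
  have hSone : (1 : A × H₀ × C) ∉ S := by
    intro h
    rcases (hSmem 1 1 1).1 h with ⟨h, -⟩ | ⟨h, h'⟩ | ⟨-, -, h⟩
    · exact h A₀.one_mem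
    · exact hS₀e h'
    · exact hc h.symm
  have hSinv : ∀ p ∈ S, p⁻¹ ∈ S := by
    rintro ⟨b, h, x⟩ hp
    refine (hSmem b⁻¹ h⁻¹ x⁻¹).2 ?_
    rcases (hSmem b h x).1 hp with ⟨hb, ht⟩ | ⟨hb, hs⟩ | ⟨rfl, rfl, rfl⟩
    · exact Or.inl ⟨by simpa using hb, hTinv _ ht⟩
    · exact Or.inr (Or.inl ⟨A₀.inv_mem hb, hS₀inv' _ hs⟩)
    · exact Or.inr (Or.inr ⟨inv_one, inv_one, hcc⟩)
  obtain ⟨a, ha, ha1⟩ := A₀.bot_or_exists_ne_one.resolve_left hA₀nt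
  have hnotS : ∀ b ∈ A₀, b ≠ 1 → ∀ x : C, (b, (1 : H₀), x) ∉ S := by
    intro b hb hb1 x h
    rcases (hSmem b 1 x).1 h with ⟨h, -⟩ | ⟨_, h⟩ | ⟨h, -⟩
    · exact h hb
    · exact hS₀A _ h rfl
    · exact hb1 h
  have hne : ∀ x : C, (1 : A × H₀ × C) ≠ (a, 1, x) := fun x h => ha1 (congrArg Prod.fst h).symm
  have hnadj : ∀ x : C, ¬(cayley S).Adj 1 (a, 1, x) := by
    intro x h
    rw [cayley_adj_iff hSone hSinv, inv_one, mul_one] at h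
    exact hnotS a ha ha1 x h
  set U := (cayley S₀).commonNeighbors 1 ((⟨a, ha⟩ : ↥A₀), (1 : H₀)) with hU
  have hUcard : U.ncard = mu₀ := by
    refine hnadj₀ _ _ (fun h => ha1 ?_) (fun h => ?_)
    · exact (congrArg (fun p : ↥A₀ × H₀ => (p.1 : A)) h).symm
    · rw [cayley_adj_iff hS₀e hS₀inv', inv_one, mul_one] at h
      exact hS₀A _ h rfl
  have hcommon : ∀ x : C, (cayley S).commonNeighbors 1 (a, 1, x) =
      {z : A × H₀ × C | z.1 ∉ A₀ ∧ z.2 ∈ T ∧ z.2 * (1, x)⁻¹ ∈ T} ∪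
        {z : A × H₀ × C | ∃ h : z.1 ∈ A₀, ((⟨z.1, h⟩ : ↥A₀), z.2.1) ∈ U} := by
    intro x
    ext ⟨b, h, y⟩
    have hmul : (b, h, y) * (a, 1, x)⁻¹ = (b * a⁻¹, h, y * x⁻¹) := by simp
    have hmulT : (h, y) * ((1 : H₀), x)⁻¹ = (h, y * x⁻¹) := by simp
    rw [mem_commonNeighbors_one_cayley_iff hSone hSinv, hmul]
    simp only [Set.mem_union, Set.mem_ofPred_eq, hmulT, hU,
      mem_commonNeighbors_one_cayley_iff hS₀e hS₀inv']
    have hba : b * a⁻¹ ∈ A₀ ↔ b ∈ A₀ := A₀.mul_mem_cancel_right (A₀.inv_mem ha)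
    have hmul₀ : ∀ hb : b ∈ A₀, ((⟨b, hb⟩ : ↥A₀), h) * ((⟨a, ha⟩ : ↥A₀), (1 : H₀))⁻¹ =
        (⟨b * a⁻¹, hba.2 hb⟩, h) := fun hb => Prod.ext rfl (by simp)
    constructor
    · rintro ⟨h1, h2⟩
      by_cases hb : b ∈ A₀
      · refine Or.inr ⟨hb, ?_, ?_⟩
        · rcases (hSmem _ _ _).1 h1 with ⟨h, -⟩ | ⟨_, hs⟩ | ⟨rfl, rfl, -⟩
          · exact absurd hb h
          · exact hs
          · refine absurd h2 (hnotS _ (hba.2 hb) ?_ _)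
            simpa using ha1
        · rcases (hSmem _ _ _).1 h2 with ⟨h, -⟩ | ⟨_, hs⟩ | ⟨hb1, rfl, -⟩
          · exact absurd (hba.2 hb) h
          · exact (hmul₀ hb).symm ▸ hs
          · obtain rfl := mul_inv_eq_one.1 hb1
            exact absurd h1 (hnotS _ hb ha1 _)
      · refine Or.inl ⟨hb, ?_, ?_⟩
        · rcases (hSmem _ _ _).1 h1 with ⟨-, h⟩ | ⟨h, -⟩ | ⟨rfl, -⟩
          · exact h
          · exact absurd h hb
          · exact absurd A₀.one_mem hb
        · rcases (hSmem _ _ _).1 h2 with ⟨-, h⟩ | ⟨h, -⟩ | ⟨h, -⟩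
          · exact h
          · exact absurd (hba.1 h) hb
          · exact absurd (hba.1 (h ▸ A₀.one_mem)) hb
    · rintro (⟨hb, h1, h2⟩ | ⟨hb, h1, h2⟩)
      · exact ⟨(hSmem _ _ _).2 (Or.inl ⟨hb, h1⟩),
          (hSmem _ _ _).2 (Or.inl ⟨fun h => hb (hba.1 h), h2⟩)⟩
      · exact ⟨(hSmem _ _ _).2 (Or.inr (Or.inl ⟨hb, h1⟩)),
          (hSmem _ _ _).2 (Or.inr (Or.inl ⟨hba.2 hb, hmul₀ hb ▸ h2⟩))⟩
  have hcard : ∀ x : C, ((cayley S).commonNeighbors 1 (a, 1, x)).ncard =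
      {z : A × H₀ × C | z.1 ∉ A₀ ∧ z.2 ∈ T ∧ z.2 * (1, x)⁻¹ ∈ T}.ncard + 2 * mu₀ := by
    intro x
    rw [hcommon, Set.ncard_union_eq, ncard_image_prod_univ, hC, hUcard, mul_comm 2]
    rw [Set.disjoint_left]
    rintro z ⟨h, -⟩ ⟨h', -⟩
    exact h h'
  have hcompl : ((A₀ : Set A)ᶜ).ncard = Nat.card A₀ := by
    have h1 := Set.ncard_add_ncard_compl (A₀ : Set A)
    have h2 := A₀.card_mul_index
    rw [hA₀idx] at h2
    have h3 : (A₀ : Set A).ncard = Nat.card A₀ := rfl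
    omega
  have hcard_one : ((cayley S).commonNeighbors 1 (a, 1, 1)).ncard = v₀ + 2 * mu₀ := by
    have hset : {z : A × H₀ × C | z.1 ∉ A₀ ∧ z.2 ∈ T ∧ z.2 * (1, 1)⁻¹ ∈ T} =
        (A₀ : Set A)ᶜ ×ˢ T := by
      ext ⟨b, h, y⟩
      simp
    rw [hcard, hset, Set.ncard_prod, hcompl, hTcard, hm₀, hv₀, Nat.card_prod]
  have hcard_c : ((cayley S).commonNeighbors 1 (a, 1, c)).ncard = 2 * mu₀ := by
    have hset : {z : A × H₀ × C | z.1 ∉ A₀ ∧ z.2 ∈ T ∧ z.2 * (1, c)⁻¹ ∈ T} = ∅ := by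
      rw [Set.eq_empty_iff_forall_notMem]
      rintro ⟨b, h, y⟩ ⟨-, h1, h2⟩
      refine hTrds.2 (1, y * c * y⁻¹) ?_ ?_ ⟨_, h1, _, h2, ?_⟩
      · simp [Subgroup.mem_prod]
      · simpa [Prod.ext_iff] using hc
      · simp [mul_assoc]
    rw [hcard, hset, Set.ncard_empty, zero_add]
  refine ⟨?_, ⟨1, (a, 1, 1), hne 1, hnadj 1, hcard_one⟩, ⟨1, (a, 1, c), hne c, hnadj c, hcard_c⟩⟩
  rintro ⟨-, -, -, μ, hμ⟩
  have h1 := hμ _ _ (hne 1) (hnadj 1)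
  have h2 := hμ _ _ (hne c) (hnadj c)
  have hpos : 0 < v₀ := hv₀ ▸ Nat.card_pos
  omega
end
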